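/- arXiv:0901.4184 — 2 statements merged into one kernel-verified Lean document; each statement's English description precedes it below -/
import Mathlib

section
/- For any λ > 0, any 0 < δ < 1, and any n ≥ 1, with probability at least 1 − 2δ over the draw of the i.i.d. training sample Z^n, every classifier h in the countable class ℋ satisfies E_λ(h) ≤ R̂_ND(h) + φ_ND(h, δ) + λ·[R̂_D(h) + φ_D(h, δ)]. -/
open MeasureTheory ENNReal

/-- The false discovery rate `R_D(h) = P(Y = 0 | h(X) = 1)`, equal to `∞` when
`P(h(X) = 1) = 0`. -/
noncomputable def RD {𝓧 : Type*} [MeasurableSpace 𝓧] (P : Measure (𝓧 × Bool))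
    (h : 𝓧 → Bool) : ℝ≥0∞ :=
  if 0 < P {z : 𝓧 × Bool | h z.1 = true} then
    P {z : 𝓧 × Bool | z.2 = false ∧ h z.1 = true} / P {z : 𝓧 × Bool | h z.1 = true}
  else ⊤

/-- The false nondiscovery rate `R_ND(h) = P(Y = 1 | h(X) = 0)`, equal to `∞` when
`P(h(X) = 0) = 0`. -/
noncomputable def RND {𝓧 : Type*} [MeasurableSpace 𝓧] (P : Measure (𝓧 × Bool))
    (h : 𝓧 → Bool) : ℝ≥0∞ :=
  if 0 < P {z : 𝓧 × Bool | h z.1 = false} then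
    P {z : 𝓧 × Bool | z.2 = true ∧ h z.1 = false} / P {z : 𝓧 × Bool | h z.1 = false}
  else ⊤

/-- The performance measure `E_λ(h) := R_ND(h) + λ · R_D(h)`. -/
noncomputable def Elam {𝓧 : Type*} [MeasurableSpace 𝓧] (P : Measure (𝓧 × Bool))
    (lam : ℝ) (h : 𝓧 → Bool) : ℝ≥0∞ :=
  RND P h + ENNReal.ofReal lam * RD P h

/-- The empirical number of discoveries `n_D(h, Zⁿ)`. -/
def nD {𝓧 : Type*} {n : ℕ} (h : 𝓧 → Bool) (ω : Fin n → 𝓧 × Bool) : ℕ :=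
  (Finset.univ.filter fun i => h (ω i).1 = true).card

/-- The empirical number of nondiscoveries `n_ND(h, Zⁿ)`. -/
def nND {𝓧 : Type*} {n : ℕ} (h : 𝓧 → Bool) (ω : Fin n → 𝓧 × Bool) : ℕ :=
  (Finset.univ.filter fun i => h (ω i).1 = false).card

/-- The empirical false discovery rate `R̂_D(h)`, equal to `∞` when `n_D(h, Zⁿ) = 0`. -/
noncomputable def RhatD {𝓧 : Type*} {n : ℕ} (h : 𝓧 → Bool) (ω : Fin n → 𝓧 × Bool) : ℝ≥0∞ :=
  if 0 < nD h ω then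
    ((Finset.univ.filter fun i => (ω i).2 = false ∧ h (ω i).1 = true).card : ℝ≥0∞)
      / (nD h ω : ℝ≥0∞)
  else ⊤

/-- The empirical false nondiscovery rate `R̂_ND(h)`, equal to `∞` when `n_ND(h, Zⁿ) = 0`. -/
noncomputable def RhatND {𝓧 : Type*} {n : ℕ} (h : 𝓧 → Bool) (ω : Fin n → 𝓧 × Bool) : ℝ≥0∞ :=
  if 0 < nND h ω then
    ((Finset.univ.filter fun i => (ω i).2 = true ∧ h (ω i).1 = false).card : ℝ≥0∞)
      / (nND h ω : ℝ≥0∞)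
  else ⊤

/-- The penalty `√((⟦h⟧ log 2 + log(2/δ)) / (2 m))`, equal to `∞` when `m = 0`. -/
noncomputable def pen (c δ : ℝ) (m : ℕ) : ℝ≥0∞ :=
  if 0 < m then ENNReal.ofReal (Real.sqrt ((c * Real.log 2 + Real.log (2 / δ)) / (2 * m)))
  else ⊤

open ProbabilityTheory in
/-- One-coordinate Hoeffding bound on the event `A`. -/
lemma aux_hoeffding {Z : Type*} [MeasurableSpace Z] (P : Measure Z) [IsProbabilityMeasure P]
    (A B : Set Z) (hA : MeasurableSet A) (hB : MeasurableSet B) (hBA : B ⊆ A)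
    (hPA : P A ≠ 0) (t : ℝ) :
    ∫⁻ z, A.indicator (fun z => ENNReal.ofReal
      (Real.exp (t * ((P B / P A).toReal - B.indicator 1 z) - t ^ 2 / 8))) z ∂P ≤ P A := by
  have hcp : IsProbabilityMeasure (ProbabilityTheory.cond P A) :=
    ProbabilityTheory.cond_isProbabilityMeasure hPA
  have hq : (P B / P A).toReal = (ProbabilityTheory.cond P A).real B := by
    rw [Measure.real, ProbabilityTheory.cond_apply hA, Set.inter_eq_self_of_subset_right hBA,
      ENNReal.div_eq_inv_mul]
  set ν := ProbabilityTheory.cond P A with hν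
  set q := (P B / P A).toReal with hqdef
  have hsub := hasSubgaussianMGF_of_mem_Icc (μ := ν) (X := fun z => -(B.indicator (1 : Z → ℝ) z))
    (a := -1) (b := 0) (((measurable_one.indicator hB).neg).aemeasurable)
    (Filter.Eventually.of_forall fun z => by
      by_cases hz : z ∈ B <;> simp [hz])
  have hint : ∫ z, -(B.indicator (1 : Z → ℝ) z) ∂ν = -q := by
    rw [integral_neg, integral_indicator_one hB, hq]
  rw [hint] at hsub
  have h1 := hsub.mgf_le t
  have h2 := hsub.integrable_exp_mul t
  rw [mgf] at h1
  have h3 : ∫⁻ z, ENNReal.ofReal (Real.exp (t * (q - B.indicator 1 z) - t ^ 2 / 8)) ∂ν ≤ 1 := by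
    have e : ∀ z, Real.exp (t * (q - B.indicator 1 z) - t ^ 2 / 8)
        = Real.exp (t * (-(B.indicator (1 : Z → ℝ) z) - -q)) * Real.exp (-(t^2/8)) := by
      intro z
      rw [← Real.exp_add]; congr 1; ring
    simp_rw [e]
    rw [← ofReal_integral_eq_lintegral_ofReal (h2.mul_const _)
      (Filter.Eventually.of_forall fun z => by positivity), integral_mul_const]
    rw [ENNReal.ofReal_le_one]
    calc _ ≤ Real.exp (t^2/8) * Real.exp (-(t^2/8)) := by
          gcongr
          refine h1.trans (le_of_eq ?_)
          congr 1
          norm_num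
          ring
      _ = 1 := by rw [← Real.exp_add]; simp
  rw [lintegral_indicator hA]
  have h4 : P.restrict A = P A • ν := by
    rw [hν, ProbabilityTheory.cond, smul_smul, ENNReal.mul_inv_cancel hPA (measure_ne_top _ _),
      one_smul]
  rw [h4, lintegral_smul_measure, smul_eq_mul]
  exact mul_le_of_le_one_right' h3

open Classical in
lemma aux_key {Z : Type*} [MeasurableSpace Z] (P : Measure Z) [IsProbabilityMeasure P]
    (A B : Set Z) (hA : MeasurableSet A) (hB : MeasurableSet B) (hBA : B ⊆ A)
    (hPA : P A ≠ 0) (n : ℕ) (L : ℝ) (hL : 0 < L) :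
    (Measure.pi fun _ : Fin n => P)
      {ω | 0 < (Finset.univ.filter fun i => ω i ∈ A).card ∧
        ((Finset.univ.filter fun i => ω i ∈ B).card : ℝ)
          + Real.sqrt (L * ((Finset.univ.filter fun i => ω i ∈ A).card : ℝ) / 2)
        ≤ (P B / P A).toReal * ((Finset.univ.filter fun i => ω i ∈ A).card : ℝ)}
      ≤ ENNReal.ofReal (Real.exp (-L)) := by
  set q := (P B / P A).toReal with hq
  let t : Finset (Fin n) → ℝ := fun S => 4 * Real.sqrt (L * (S.card : ℝ) / 2) / S.card
  let f : Finset (Fin n) → Fin n → Z → ℝ≥0∞ := fun S i z =>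
    if i ∈ S then A.indicator (fun z => ENNReal.ofReal
      (Real.exp (t S * (q - B.indicator 1 z) - t S ^ 2 / 8))) z
    else Aᶜ.indicator 1 z
  have hfm : ∀ S i, Measurable (f S i) := by
    intro S i
    by_cases hi : i ∈ S
    · simp only [f, hi, if_true]
      refine Measurable.indicator ?_ hA
      have : Measurable (B.indicator (1 : Z → ℝ)) := measurable_one.indicator hB
      fun_prop
    · simp only [f, hi, if_false]
      exact measurable_one.indicator hA.compl
  have hfi : ∀ S i, ∫⁻ z, f S i z ∂P ≤ if i ∈ S then P A else P Aᶜ := by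
    intro S i
    by_cases hi : i ∈ S
    · simp only [f, hi, if_true]
      exact aux_hoeffding P A B hA hB hBA hPA _
    · simp only [f, hi, if_false]
      rw [lintegral_indicator_one hA.compl]
  have hFm : ∀ S, Measurable (fun ω : Fin n → Z => ∏ i, f S i (ω i)) := fun S =>
    Finset.measurable_prod _ fun i _ => (hfm S i).comp (measurable_pi_apply i)
  have hF : ∫⁻ ω, ∑ S : Finset (Fin n), ∏ i, f S i (ω i) ∂(Measure.pi fun _ : Fin n => P) ≤ 1 := by
    rw [lintegral_finsetSum _ fun S _ => hFm S]
    calc _ ≤ ∑ S : Finset (Fin n), ∏ i, (if i ∈ S then P A else P Aᶜ) := by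
          gcongr with S
          have hind := ProbabilityTheory.iIndepFun_pi (μ := fun _ : Fin n => P)
            (X := fun i => f S i) (fun i => (hfm S i).aemeasurable)
          rw [ProbabilityTheory.lintegral_prod_eq_prod_lintegral_of_indepFun Finset.univ _ hind
            (fun i => (hfm S i).comp (measurable_pi_apply i))]
          gcongr with i
          rw [(measurePreserving_eval (fun _ : Fin n => P) i).lintegral_comp (hfm S i)]
          exact hfi S i
      _ = ∏ i : Fin n, (P A + P Aᶜ) := by
          rw [Finset.prod_add, Finset.powerset_univ]
          refine Finset.sum_congr rfl fun S _ => ?_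
          rw [Finset.prod_ite]
          congr 2
          · ext; simp
          · ext; simp
      _ = 1 := by simp [measure_add_measure_compl hA]
  have hmk := mul_meas_ge_le_lintegral (μ := Measure.pi fun _ : Fin n => P)
    (Finset.measurable_sum Finset.univ fun S _ => hFm S) (ENNReal.ofReal (Real.exp L))
  have hexp : ENNReal.ofReal (Real.exp (-L)) = (ENNReal.ofReal (Real.exp L))⁻¹ := by
    rw [Real.exp_neg, ENNReal.ofReal_inv_of_pos (Real.exp_pos _)]
  rw [hexp, ENNReal.le_inv_iff_mul_le, mul_comm]
  refine le_trans ?_ (hmk.trans hF)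
  gcongr
  rename_i ω; rintro ⟨hN, hω⟩
  set S := Finset.univ.filter fun i => ω i ∈ A with hS
  show _ ≤ _
  refine le_trans ?_ (Finset.single_le_sum (f := fun S => ∏ i, f S i (ω i))
    (fun _ _ => zero_le) (Finset.mem_univ S))
  have hprod : ∏ i, f S i (ω i) = ENNReal.ofReal (Real.exp
      (∑ i ∈ S, (t S * (q - B.indicator 1 (ω i)) - t S ^ 2 / 8))) := by
    rw [Real.exp_sum, ENNReal.ofReal_prod_of_nonneg (fun _ _ => (Real.exp_pos _).le),
      ← Finset.prod_subset (Finset.subset_univ S)]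
    · refine Finset.prod_congr rfl fun i hi => ?_
      have hiA : ω i ∈ A := by simpa [hS] using hi
      simp only [f, hi, if_true, Set.indicator_of_mem hiA]
    · intro i _ hi
      have hiA : ω i ∈ Aᶜ := by simpa [hS] using hi
      simp only [f, hi, if_false, Set.indicator_of_mem hiA, Pi.one_apply]
  have hK : ∑ i ∈ S, B.indicator (1 : Z → ℝ) (ω i)
      = ((Finset.univ.filter fun i => ω i ∈ B).card : ℝ) := by
    have hsub : (Finset.univ.filter fun i => ω i ∈ B) ⊆ S := by
      intro i; simp only [hS, Finset.mem_filter, Finset.mem_univ, true_and]; exact fun h => hBA h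
    rw [← Finset.sum_subset hsub]
    · rw [Finset.sum_congr rfl (g := fun _ => (1:ℝ))]
      · simp
      · intro i hi
        have hiB : ω i ∈ B := by simpa using hi
        simp [hiB]
    · intro i _ hi
      have hiB : ω i ∉ B := by simpa using hi
      simp [hiB]
  rw [hprod]
  apply ENNReal.ofReal_le_ofReal
  apply Real.exp_le_exp.2
  rw [Finset.sum_sub_distrib, ← Finset.mul_sum, Finset.sum_sub_distrib, hK]
  simp only [Finset.sum_const, nsmul_eq_mul]
  have hN' : (0:ℝ) < S.card := by exact_mod_cast hN
  have hs2 : Real.sqrt (L * (S.card : ℝ) / 2) ^ 2 = L * (S.card : ℝ) / 2 :=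
    Real.sq_sqrt (by positivity)
  have hs0 := Real.sqrt_nonneg (L * (S.card : ℝ) / 2)
  simp only [t]
  set s := Real.sqrt (L * (S.card : ℝ) / 2)
  set N : ℝ := (S.card : ℝ)
  set K : ℝ := ((Finset.univ.filter fun i => ω i ∈ B).card : ℝ)
  have h1 : N * ((4 * s / N) ^ 2 / 8) = L := by
    field_simp; rw [hs2]; ring
  have h2 : 4 * s / N * s = 2 * L := by
    field_simp; rw [hs2]; ring
  have h3 : 4 * s / N * s ≤ 4 * s / N * (N * q - K) := by
    gcongr; linarith
  linarith

open Classical in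
lemma aux_event {Z : Type*} [MeasurableSpace Z] (P : Measure Z) [IsProbabilityMeasure P]
    (A B : Set Z) (hA : MeasurableSet A) (hB : MeasurableSet B) (hBA : B ⊆ A)
    (n : ℕ) (c δ : ℝ) (hL : 0 < c * Real.log 2 + Real.log (2 / δ)) :
    (Measure.pi fun _ : Fin n => P)
      {ω | ¬ ((if 0 < P A then P B / P A else ⊤) ≤
        (if 0 < (Finset.univ.filter fun i => ω i ∈ A).card then
          ((Finset.univ.filter fun i => ω i ∈ B).card : ℝ≥0∞) /
            ((Finset.univ.filter fun i => ω i ∈ A).card : ℝ≥0∞) else ⊤)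
        + pen c δ (Finset.univ.filter fun i => ω i ∈ A).card)}
      ≤ ENNReal.ofReal (Real.exp (-(c * Real.log 2 + Real.log (2 / δ)))) := by
  by_cases hPA : P A = 0
  · refine le_trans (le_of_eq ?_) zero_le
    refine measure_mono_null (t := ⋃ i : Fin n, (fun ω : Fin n → Z => ω i) ⁻¹' A) ?_ ?_
    · intro ω hω
      by_contra hc
      apply hω
      have : ¬ 0 < (Finset.univ.filter fun i => ω i ∈ A).card := by
        simpa [Finset.filter_eq_empty_iff] using hc
      simp [this]
    · refine measure_iUnion_null fun i => ?_
      rw [(measurePreserving_eval (fun _ : Fin n => P) i).measure_preimage hA.nullMeasurableSet,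
        hPA]
  · refine le_trans (measure_mono ?_) (aux_key P A B hA hB hBA hPA n _ hL)
    intro ω hω
    simp only [Set.mem_ofPred_eq] at hω ⊢
    set L := c * Real.log 2 + Real.log (2 / δ)
    set N := (Finset.univ.filter fun i => ω i ∈ A).card
    set K := (Finset.univ.filter fun i => ω i ∈ B).card
    by_cases hN : 0 < N
    · refine ⟨hN, ?_⟩
      have hN' : (0:ℝ) < N := by exact_mod_cast hN
      rw [if_pos (pos_iff_ne_zero.2 hPA), if_pos hN, pen, if_pos hN, not_le] at hω
      have hfin : P B / P A ≠ ⊤ := ENNReal.div_ne_top (measure_ne_top _ _) hPA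
      have e : (K : ℝ≥0∞) / N = ENNReal.ofReal (K / N) := by
        rw [ENNReal.ofReal_div_of_pos hN', ENNReal.ofReal_natCast, ENNReal.ofReal_natCast]
      rw [e, ← ENNReal.ofReal_add (by positivity) (Real.sqrt_nonneg _),
        ENNReal.ofReal_lt_iff_lt_toReal (by positivity) hfin] at hω
      have h2 : Real.sqrt (L * N / 2) = Real.sqrt (L / (2 * N)) * N := by
        rw [← Real.sqrt_sq hN'.le, ← Real.sqrt_mul (by positivity), Real.sqrt_sq hN'.le]
        congr 1
        field_simp
      rw [h2]
      calc (K:ℝ) + Real.sqrt (L / (2 * N)) * N = (K / N + Real.sqrt (L / (2 * N))) * N := by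
            field_simp
        _ ≤ _ := by gcongr
    · exact absurd (by simp [hN]) hω

/-- **Corollary 1.** For any `λ > 0`, `0 < δ < 1` and `n ≥ 1`, with probability at least
`1 - 2δ` over the draw of the i.i.d. training sample, every `h` in the countable class `H`
satisfies `E_λ(h) ≤ R̂_ND(h) + φ_ND(h, δ) + λ·[R̂_D(h) + φ_D(h, δ)]`. -/
theorem fdr_performance_bound
    {𝓧 : Type*} [MeasurableSpace 𝓧] (P : Measure (𝓧 × Bool)) [IsProbabilityMeasure P]
    (H : Set (𝓧 → Bool)) (hHcount : H.Countable) (hHmeas : ∀ h ∈ H, Measurable h)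
    (cl : (𝓧 → Bool) → ℝ)
    (hKraft : ∑' h : H, (2 : ℝ≥0∞) ^ (-(cl h.1)) ≤ 1)
    (lam : ℝ) (hlam : 0 < lam)
    (n : ℕ) (hn : 1 ≤ n) (δ : ℝ) (hδ0 : 0 < δ) (hδ1 : δ < 1) :
    ENNReal.ofReal (1 - 2 * δ) ≤
      (Measure.pi fun _ : Fin n => P)
        {ω | ∀ h ∈ H,
          Elam P lam h ≤
            RhatND h ω + pen (cl h) δ (nND h ω) +
              ENNReal.ofReal lam * (RhatD h ω + pen (cl h) δ (nD h ω))} := by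
  classical
  set μ := (Measure.pi fun _ : Fin n => P) with hμ
  have hcl : ∀ h ∈ H, 0 ≤ cl h := by
    intro h hh
    by_contra hc
    push Not at hc
    have h1 := (ENNReal.le_tsum (f := fun h : H => (2 : ℝ≥0∞) ^ (-(cl h.1))) ⟨h, hh⟩).trans hKraft
    exact absurd h1 (not_le.2 (ENNReal.one_lt_rpow (by norm_num) (by simpa using hc)))
  have hlog : 0 < Real.log (2 / δ) := by
    apply Real.log_pos
    rw [lt_div_iff₀ hδ0]; linarith
  have hexp : ∀ h, ENNReal.ofReal (Real.exp (-(cl h * Real.log 2 + Real.log (2 / δ))))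
      = (2 : ℝ≥0∞) ^ (-(cl h)) * ENNReal.ofReal (δ / 2) := by
    intro h
    rw [neg_add, Real.exp_add, ENNReal.ofReal_mul (Real.exp_pos _).le, Real.exp_neg (Real.log _),
      Real.exp_log (by positivity), inv_div]
    congr 1
    rw [show (2 : ℝ≥0∞) = ENNReal.ofReal 2 by simp, ENNReal.ofReal_rpow_of_pos (by norm_num),
      Real.rpow_def_of_pos (by norm_num)]
    congr 2; ring
  let bD : (𝓧 → Bool) → Set (Fin n → 𝓧 × Bool) := fun h =>
    {ω | ¬ (RD P h ≤ RhatD h ω + pen (cl h) δ (nD h ω))}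
  let bN : (𝓧 → Bool) → Set (Fin n → 𝓧 × Bool) := fun h =>
    {ω | ¬ (RND P h ≤ RhatND h ω + pen (cl h) δ (nND h ω))}
  have hbD : ∀ h ∈ H, μ (bD h) ≤ (2 : ℝ≥0∞) ^ (-(cl h)) * ENNReal.ofReal (δ / 2) := by
    intro h hh
    have hm := hHmeas h hh
    rw [← hexp]
    have hL : 0 < cl h * Real.log 2 + Real.log (2 / δ) := by
      have := mul_nonneg (hcl h hh) (Real.log_nonneg one_le_two)
      linarith
    have hA : MeasurableSet {z : 𝓧 × Bool | h z.1 = true} :=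
      (hm.comp measurable_fst) (measurableSet_singleton true)
    have hB : MeasurableSet {z : 𝓧 × Bool | z.2 = false ∧ h z.1 = true} :=
      (measurable_snd (measurableSet_singleton false)).inter hA
    convert aux_event P _ _ hA hB (fun z hz => hz.2) n (cl h) δ hL using 2
    ext ω
    simp only [bD, RD, RhatD, nD, Set.mem_ofPred_eq]
    congr!
  have hbN : ∀ h ∈ H, μ (bN h) ≤ (2 : ℝ≥0∞) ^ (-(cl h)) * ENNReal.ofReal (δ / 2) := by
    intro h hh
    have hm := hHmeas h hh
    rw [← hexp]
    have hL : 0 < cl h * Real.log 2 + Real.log (2 / δ) := by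
      have := mul_nonneg (hcl h hh) (Real.log_nonneg one_le_two)
      linarith
    have hA : MeasurableSet {z : 𝓧 × Bool | h z.1 = false} :=
      (hm.comp measurable_fst) (measurableSet_singleton false)
    have hB : MeasurableSet {z : 𝓧 × Bool | z.2 = true ∧ h z.1 = false} :=
      (measurable_snd (measurableSet_singleton true)).inter hA
    convert aux_event P _ _ hA hB (fun z hz => hz.2) n (cl h) δ hL using 2
    ext ω
    simp only [bN, RND, RhatND, nND, Set.mem_ofPred_eq]
    congr!
  have : Countable H := hHcount.to_subtype
  have hbad : μ (⋃ h : H, (bD h.1 ∪ bN h.1)) ≤ ENNReal.ofReal (2 * δ) := by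
    calc _ ≤ ∑' h : H, μ (bD h.1 ∪ bN h.1) := measure_iUnion_le _
      _ ≤ ∑' h : H, (2 : ℝ≥0∞) ^ (-(cl h.1)) * ENNReal.ofReal δ := by
        refine ENNReal.tsum_le_tsum fun h => ?_
        refine (measure_union_le _ _).trans ((add_le_add (hbD _ h.2) (hbN _ h.2)).trans ?_)
        rw [← mul_add, ← ENNReal.ofReal_add (by positivity) (by positivity), add_halves]
      _ ≤ 1 * ENNReal.ofReal δ := by
        rw [ENNReal.tsum_mul_right]; gcongr
      _ ≤ _ := by
        rw [one_mul]; exact ENNReal.ofReal_le_ofReal (by linarith)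
  set G := {ω : Fin n → 𝓧 × Bool | ∀ h ∈ H,
          Elam P lam h ≤
            RhatND h ω + pen (cl h) δ (nND h ω) +
              ENNReal.ofReal lam * (RhatD h ω + pen (cl h) δ (nD h ω))} with hG
  have hGc : Gᶜ ⊆ ⋃ h : H, (bD h.1 ∪ bN h.1) := by
    intro ω hω
    by_contra hc
    apply hω
    intro h hh
    simp only [Set.mem_iUnion, Set.mem_union, not_exists, not_or] at hc
    obtain ⟨h1, h2⟩ := hc ⟨h, hh⟩
    have h1' : RD P h ≤ RhatD h ω + pen (cl h) δ (nD h ω) := not_not.1 h1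
    have h2' : RND P h ≤ RhatND h ω + pen (cl h) δ (nND h ω) := not_not.1 h2
    unfold Elam
    gcongr
  have h1 : (1 : ℝ≥0∞) ≤ μ G + ENNReal.ofReal (2 * δ) := by
    calc (1 : ℝ≥0∞) = μ (G ∪ Gᶜ) := by rw [Set.union_compl_self, measure_univ]
      _ ≤ μ G + μ Gᶜ := measure_union_le _ _
      _ ≤ _ := by gcongr; exact (measure_mono hGc).trans hbad
  rw [ENNReal.ofReal_sub _ (by positivity), ENNReal.ofReal_one]
  exact tsub_le_iff_right.2 h1
end

section
/- Let ℋ be countable with codelengths satisfying the Kraft inequality, fix 0 < α < 1, let h* := argmin_{h∈ℋ} R_FN(h) subject to R_FP(h) ≤ α, and let ĥ := argmin_{h∈ℋ} R̂_FN(h) + φ_FN(h, δ) subject to R̂_FP(h) ≤ α + φ_FP(h, δ). Then for any δ > 0 and any n ≥ 1, with probability at least 1 − 2δ over the draw of the training data, both R_FN(ĥ) ≤ R_FN(h*) + 2 φ_FN(h*, δ) and R_FP(ĥ) ≤ α + 2 φ_FP(ĥ, δ). -/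
open MeasureTheory ENNReal

/-- The false positive rate `R_FP(h) = P(h(X) = 1 | Y = 0)`. -/
noncomputable def RFP {𝓧 : Type*} [MeasurableSpace 𝓧] (P : Measure (𝓧 × Bool))
    (h : 𝓧 → Bool) : ℝ≥0∞ :=
  P {z : 𝓧 × Bool | h z.1 = true ∧ z.2 = false} / P {z : 𝓧 × Bool | z.2 = false}

/-- The false negative rate `R_FN(h) = P(h(X) = 0 | Y = 1)`. -/
noncomputable def RFN {𝓧 : Type*} [MeasurableSpace 𝓧] (P : Measure (𝓧 × Bool))
    (h : 𝓧 → Bool) : ℝ≥0∞ :=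
  P {z : 𝓧 × Bool | h z.1 = false ∧ z.2 = true} / P {z : 𝓧 × Bool | z.2 = true}

/-- The number of negative training examples `n₀`. -/
def nneg {𝓧 : Type*} {n : ℕ} (ω : Fin n → 𝓧 × Bool) : ℕ :=
  (Finset.univ.filter fun i => (ω i).2 = false).card

/-- The number of positive training examples `n₁`. -/
def npos {𝓧 : Type*} {n : ℕ} (ω : Fin n → 𝓧 × Bool) : ℕ :=
  (Finset.univ.filter fun i => (ω i).2 = true).card

/-- The empirical false positive rate, equal to `0` when `n₀ = 0`. -/
noncomputable def RhatFP {𝓧 : Type*} {n : ℕ} (h : 𝓧 → Bool) (ω : Fin n → 𝓧 × Bool) : ℝ≥0∞ :=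
  if 0 < nneg ω then
    ((Finset.univ.filter fun i => (ω i).2 = false ∧ h (ω i).1 = true).card : ℝ≥0∞)
      / (nneg ω : ℝ≥0∞)
  else 0

/-- The empirical false negative rate, equal to `0` when `n₁ = 0`. -/
noncomputable def RhatFN {𝓧 : Type*} {n : ℕ} (h : 𝓧 → Bool) (ω : Fin n → 𝓧 × Bool) : ℝ≥0∞ :=
  if 0 < npos ω then
    ((Finset.univ.filter fun i => (ω i).2 = true ∧ h (ω i).1 = false).card : ℝ≥0∞)
      / (npos ω : ℝ≥0∞)
  else 0

/-- The penalty `√((⟦h⟧ log 2 + log(2/δ)) / (2 m))`, equal to `1` when `m = 0`. -/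
noncomputable def penNP (c δ : ℝ) (m : ℕ) : ℝ≥0∞ :=
  if 0 < m then ENNReal.ofReal (Real.sqrt ((c * Real.log 2 + Real.log (2 / δ)) / (2 * m)))
  else 1

open ProbabilityTheory in
theorem np_lintegral_pi {Z : Type*} [MeasurableSpace Z] (P : Measure Z) [IsProbabilityMeasure P]
    {n : ℕ} (f : Fin n → Z → ℝ≥0∞) (hf : ∀ i, Measurable (f i)) :
    ∫⁻ ω, ∏ i, f i (ω i) ∂(Measure.pi fun _ : Fin n => P) = ∏ i, ∫⁻ z, f i z ∂P := by
  have hind : iIndepFun (fun i (ω : Fin n → Z) => f i (ω i)) (Measure.pi fun _ : Fin n => P) :=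
    iIndepFun_pi (fun i => (hf i).aemeasurable)
  have h := lintegral_prod_eq_prod_lintegral_of_indepFun (μ := Measure.pi fun _ : Fin n => P)
    Finset.univ (fun i (ω : Fin n → Z) => f i (ω i)) hind
    (fun i => (hf i).comp (measurable_pi_apply i))
  rw [h]
  refine Finset.prod_congr rfl fun i _ => ?_
  exact (measurePreserving_eval (fun _ : Fin n => P) i).lintegral_comp (hf i)

open ProbabilityTheory in
theorem np_mgf {Z : Type*} [MeasurableSpace Z] (P : Measure Z) [IsProbabilityMeasure P]
    (A : Set Z) (hA : MeasurableSet A) (hA0 : P A ≠ 0) (X : Z → ℝ) (hX : Measurable X)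
    (a b : ℝ) (hab : b - a = 1) (hXab : ∀ z, X z ∈ Set.Icc a b)
    (hmean : ∫ z, X z ∂(cond P A) = 0) (u : ℝ) :
    ∫⁻ z, A.indicator (fun z => ENNReal.ofReal (Real.exp (4 * u * (X z - u)))) z ∂P
      ≤ P A * ENNReal.ofReal (Real.exp (-(2 * u ^ 2))) := by
  have : IsProbabilityMeasure (cond P A) := cond_isProbabilityMeasure hA0
  have hsg := hasSubgaussianMGF_of_mem_Icc_of_integral_eq_zero (μ := cond P A) (X := X)
    hX.aemeasurable (ae_of_all _ hXab) hmean
  have hm := hsg.mgf_le (4 * u)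
  have hi := hsg.integrable_exp_mul (4 * u)
  rw [hab] at hm
  have hres : P.restrict A = P A • cond P A := by
    rw [ProbabilityTheory.cond, smul_smul, ENNReal.mul_inv_cancel hA0 (measure_ne_top _ _), one_smul]
  rw [lintegral_indicator hA, hres, lintegral_smul_measure, smul_eq_mul]
  gcongr
  have he : ∀ z, Real.exp (4 * u * (X z - u)) = Real.exp (-(4 * u ^ 2)) * Real.exp (4 * u * X z) := by
    intro z; rw [← Real.exp_add]; congr 1; ring
  simp_rw [he]
  rw [← ofReal_integral_eq_lintegral_ofReal (hi.const_mul _) (ae_of_all _ fun z => by positivity),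
    integral_const_mul]
  apply ENNReal.ofReal_le_ofReal
  have : ∫ z, Real.exp (4 * u * X z) ∂(cond P A) ≤ Real.exp (2 * u ^ 2) := by
    refine hm.trans (le_of_eq ?_)
    congr 1
    simp
    ring
  calc _ ≤ Real.exp (-(4 * u ^ 2)) * Real.exp (2 * u ^ 2) := by gcongr
    _ = _ := by rw [← Real.exp_add]; congr 1; ring

open ProbabilityTheory Classical in
theorem np_core {Z : Type*} [MeasurableSpace Z] (P : Measure Z) [IsProbabilityMeasure P]
    (A : Set Z) (hA : MeasurableSet A) (hA0 : P A ≠ 0) (X : Z → ℝ) (hX : Measurable X)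
    (a b : ℝ) (hab : b - a = 1) (hXab : ∀ z, X z ∈ Set.Icc a b)
    (hmean : ∫ z, X z ∂(cond P A) = 0) (L : ℝ) (n : ℕ) :
    (Measure.pi fun _ : Fin n => P)
      {ω | 0 < (Finset.univ.filter fun i => ω i ∈ A).card ∧
        Real.sqrt (L / (2 * ((Finset.univ.filter fun i => ω i ∈ A).card : ℕ)))
            * (Finset.univ.filter fun i => ω i ∈ A).card
          < ∑ i ∈ Finset.univ.filter (fun i => ω i ∈ A), X (ω i)}
      ≤ ENNReal.ofReal (Real.exp (-L)) := by
  rcases lt_or_ge L 0 with hL | hL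
  · refine prob_le_one.trans ?_
    rw [ENNReal.one_le_ofReal]
    exact Real.one_le_exp (by linarith)
  set μ := Measure.pi fun _ : Fin n => P
  set u : ℕ → ℝ := fun k => Real.sqrt (L / (2 * k)) with hu
  let E : Finset (Fin n) → Set (Fin n → Z) := fun S =>
    {ω | (Finset.univ.filter fun i => ω i ∈ A) = S ∧ 0 < S.card ∧
      u S.card * S.card < ∑ i ∈ S, X (ω i)}
  have hE : ∀ S, μ (E S) ≤ ENNReal.ofReal (Real.exp (-L)) * (P A ^ S.card * P Aᶜ ^ (n - S.card)) := by
    intro S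
    by_cases hS : 0 < S.card
    swap
    · have : E S = ∅ := by
        ext ω; simp only [E, Set.mem_ofPred_eq, Set.mem_empty_iff_false, iff_false]; tauto
      simp [this]
    set v := u S.card
    have hv0 : 0 ≤ v := Real.sqrt_nonneg _
    let f : Fin n → Z → ℝ≥0∞ := fun i => if i ∈ S then
      A.indicator (fun z => ENNReal.ofReal (Real.exp (4 * v * (X z - v)))) else Aᶜ.indicator 1
    have hf : ∀ i, Measurable (f i) := by
      intro i
      by_cases hi : i ∈ S
      · simp only [f, hi, if_true]
        exact Measurable.indicator (by fun_prop) hA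
      · simp only [f, hi, if_false]
        exact Measurable.indicator measurable_const hA.compl
    have hsub : ∀ ω ∈ E S, 1 ≤ ∏ i, f i (ω i) := by
      intro ω hω
      obtain ⟨h1, -, h3⟩ := hω
      have hfi : ∀ i, f i (ω i) = if i ∈ S then ENNReal.ofReal (Real.exp (4 * v * (X (ω i) - v))) else 1 := by
        intro i
        by_cases hi : i ∈ S
        · have : ω i ∈ A := by rw [← h1] at hi; simpa using hi
          simp [f, hi, this]
        · have : ω i ∉ A := by rw [← h1] at hi; simpa using hi
          simp [f, hi, this]
      simp_rw [hfi]
      rw [Finset.prod_ite_mem, Finset.univ_inter,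
        ← ENNReal.ofReal_prod_of_nonneg (fun i _ => (Real.exp_pos _).le), ← Real.exp_sum,
        ENNReal.one_le_ofReal]
      apply Real.one_le_exp
      rw [← Finset.mul_sum, Finset.sum_sub_distrib]
      simp only [Finset.sum_const, nsmul_eq_mul]
      have : 0 ≤ ∑ i ∈ S, X (ω i) - S.card * v := by
        have := h3; simp only [v]; linarith
      positivity
    calc μ (E S) ≤ μ {ω | 1 ≤ ∏ i, f i (ω i)} := measure_mono hsub
      _ ≤ ∫⁻ ω, ∏ i, f i (ω i) ∂μ := by
        have := mul_meas_ge_le_lintegral (μ := μ) (f := fun ω => ∏ i, f i (ω i))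
          (Finset.measurable_prod _ fun i _ => (hf i).comp (measurable_pi_apply i)) 1
        simpa using this
      _ = ∏ i, ∫⁻ z, f i z ∂P := np_lintegral_pi P f hf
      _ ≤ ∏ i, (if i ∈ S then P A * ENNReal.ofReal (Real.exp (-(2 * v ^ 2))) else P Aᶜ) := by
        refine Finset.prod_le_prod' fun i _ => ?_
        by_cases hi : i ∈ S
        · simp only [f, hi, if_true]
          exact np_mgf P A hA hA0 X hX a b hab hXab hmean v
        · simp only [f, hi, if_false]
          rw [lintegral_indicator_one hA.compl]
      _ = (P A * ENNReal.ofReal (Real.exp (-(2 * v ^ 2)))) ^ S.card * P Aᶜ ^ (n - S.card) := by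
        rw [Finset.prod_ite, Finset.prod_const, Finset.prod_const]
        have e1 : (Finset.univ.filter fun i => i ∈ S) = S := by ext; simp
        have e2 : (Finset.univ.filter fun i => i ∉ S) = Sᶜ := by ext; simp
        rw [e1, e2, Finset.card_compl, Fintype.card_fin]
      _ = _ := by
        rw [mul_pow, ← ENNReal.ofReal_pow (Real.exp_pos _).le, ← Real.exp_nat_mul]
        have : (S.card : ℝ) * -(2 * v ^ 2) = -L := by
          have hk : (0:ℝ) < S.card := by exact_mod_cast hS
          have : v ^ 2 = L / (2 * S.card) := Real.sq_sqrt (by positivity)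
          rw [this]; field_simp
        rw [this]; ring
  calc _ ≤ μ (⋃ S ∈ (Finset.univ : Finset (Finset (Fin n))), E S) := by
        apply measure_mono
        intro ω hω
        simp only [Finset.mem_univ, Set.iUnion_true, Set.mem_iUnion]
        exact ⟨_, rfl, hω.1, hω.2⟩
    _ ≤ ∑ S, μ (E S) := measure_biUnion_finset_le _ _
    _ ≤ ∑ S : Finset (Fin n), ENNReal.ofReal (Real.exp (-L)) * (P A ^ S.card * P Aᶜ ^ (n - S.card)) :=
        Finset.sum_le_sum fun S _ => hE S
    _ = ENNReal.ofReal (Real.exp (-L)) := by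
        rw [← Finset.mul_sum, Fin.sum_pow_mul_eq_add_pow, measure_add_measure_compl hA]
        simp

/-- Error rate on class `b`. -/
noncomputable def npR {𝓧 : Type*} [MeasurableSpace 𝓧] (P : Measure (𝓧 × Bool)) (b : Bool)
    (h : 𝓧 → Bool) : ℝ≥0∞ :=
  P {z : 𝓧 × Bool | h z.1 = (!b) ∧ z.2 = b} / P {z : 𝓧 × Bool | z.2 = b}

/-- Number of samples in class `b`. -/
def npCnt {𝓧 : Type*} {n : ℕ} (b : Bool) (ω : Fin n → 𝓧 × Bool) : ℕ :=
  (Finset.univ.filter fun i => (ω i).2 = b).card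

/-- Empirical error rate on class `b`. -/
noncomputable def npRhat {𝓧 : Type*} {n : ℕ} (b : Bool) (h : 𝓧 → Bool)
    (ω : Fin n → 𝓧 × Bool) : ℝ≥0∞ :=
  if 0 < npCnt b ω then
    ((Finset.univ.filter fun i => (ω i).2 = b ∧ h (ω i).1 = (!b)).card : ℝ≥0∞)
      / (npCnt b ω : ℝ≥0∞)
  else 0

/-- The good event. -/
def npGood {𝓧 : Type*} [MeasurableSpace 𝓧] (P : Measure (𝓧 × Bool)) {n : ℕ} (b : Bool)
    (h : 𝓧 → Bool) (c δ : ℝ) (ω : Fin n → 𝓧 × Bool) : Prop :=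
  npR P b h ≤ npRhat b h ω + penNP c δ (npCnt b ω) ∧
    npRhat b h ω ≤ npR P b h + penNP c δ (npCnt b ω)

theorem npR_le_one {𝓧 : Type*} [MeasurableSpace 𝓧] (P : Measure (𝓧 × Bool)) (b : Bool)
    (h : 𝓧 → Bool) : npR P b h ≤ 1 :=
  ENNReal.div_le_of_le_mul (by rw [one_mul]; exact measure_mono fun z hz => hz.2)

open ProbabilityTheory in
theorem np_dev {𝓧 : Type*} [MeasurableSpace 𝓧] (P : Measure (𝓧 × Bool)) [IsProbabilityMeasure P]
    (b : Bool) (hP : 0 < P {z : 𝓧 × Bool | z.2 = b}) (h : 𝓧 → Bool) (hh : Measurable h)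
    (c δ : ℝ) (hδ : 0 < δ) (n : ℕ) :
    (Measure.pi fun _ : Fin n => P) {ω | ¬ npGood P b h c δ ω}
      ≤ ENNReal.ofReal δ * (2 : ℝ≥0∞) ^ (-c) := by
  classical
  set L := c * Real.log 2 + Real.log (2 / δ) with hLdef
  set A : Set (𝓧 × Bool) := {z | z.2 = b} with hAdef
  set B : Set (𝓧 × Bool) := {z | h z.1 = (!b) ∧ z.2 = b} with hBdef
  have hA : MeasurableSet A := measurable_snd (measurableSet_singleton b)
  have hB : MeasurableSet B :=
    (((hh.comp measurable_fst) (measurableSet_singleton (!b)))).inter hA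
  have hA0 : P A ≠ 0 := hP.ne'
  have hcp : IsProbabilityMeasure (ProbabilityTheory.cond P A) := cond_isProbabilityMeasure hA0
  set p := (npR P b h).toReal with hp
  have hR : npR P b h = ENNReal.ofReal p :=
    (ENNReal.ofReal_toReal ((npR_le_one P b h).trans_lt ENNReal.one_lt_top).ne).symm
  let f : 𝓧 × Bool → ℝ := B.indicator 1
  have hf : Measurable f := measurable_const.indicator hB
  have hf01 : ∀ z, 0 ≤ f z ∧ f z ≤ 1 := by
    intro z; by_cases hz : z ∈ B <;> simp [f, hz]
  have hfi : Integrable f (ProbabilityTheory.cond P A) :=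
    Integrable.of_mem_Icc 0 1 hf.aemeasurable (ae_of_all _ fun z => hf01 z)
  have hfint : ∫ z, f z ∂(ProbabilityTheory.cond P A) = p := by
    rw [integral_indicator_one hB, Measure.real, cond_apply hA]
    have : A ∩ B = B := Set.inter_eq_right.2 fun z hz => hz.2
    rw [this, hp, npR, ENNReal.div_eq_inv_mul]
  have h1 := np_core P A hA hA0 (fun z => f z - p) (hf.sub_const p) (-p) (1 - p) (by ring)
    (fun z => ⟨by linarith [(hf01 z).1], by linarith [(hf01 z).2]⟩)
    (by rw [integral_sub hfi (integrable_const _), hfint]; simp) L n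
  have h2 := np_core P A hA hA0 (fun z => p - f z) (hf.const_sub p) (p - 1) p (by ring)
    (fun z => ⟨by linarith [(hf01 z).2], by linarith [(hf01 z).1]⟩)
    (by rw [integral_sub (integrable_const _) hfi, hfint]; simp) L n
  have hexp : ENNReal.ofReal (Real.exp (-L)) + ENNReal.ofReal (Real.exp (-L))
      = ENNReal.ofReal δ * (2 : ℝ≥0∞) ^ (-c) := by
    have e2 : (2 : ℝ≥0∞) ^ (-c) = ENNReal.ofReal ((2:ℝ) ^ (-c)) := by
      rw [← ENNReal.ofReal_rpow_of_pos (by norm_num)]; simp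
    rw [e2, ← ENNReal.ofReal_mul hδ.le, ← ENNReal.ofReal_add (by positivity) (by positivity)]
    congr 1
    have : -L = Real.log 2 * (-c) + Real.log (δ / 2) := by
      rw [hLdef, Real.log_div (by norm_num) hδ.ne', Real.log_div hδ.ne' (by norm_num)]; ring
    rw [this, Real.exp_add, Real.exp_log (by positivity), Real.rpow_def_of_pos (by norm_num)]
    ring
  rw [← hexp]
  refine le_trans ?_ (add_le_add h1 h2)
  refine le_trans (measure_mono ?_) (measure_union_le _ _)
  intro ω hω
  by_contra hcon
  apply hω
  simp only [Set.mem_union, Set.mem_ofPred_eq, not_or, not_and, not_lt] at hcon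
  obtain ⟨c1, c2⟩ := hcon
  have hcnt : ∀ inst : DecidablePred (fun i => ω i ∈ A),
      (@Finset.filter _ (fun i => ω i ∈ A) inst Finset.univ).card = npCnt b ω := by
    intro inst
    unfold npCnt
    congr 1
    ext i
    simp [A]
  have hs : ∀ inst : DecidablePred (fun i => ω i ∈ A),
      ∑ i ∈ @Finset.filter _ (fun i => ω i ∈ A) inst Finset.univ, f (ω i)
      = ((Finset.univ.filter fun i => (ω i).2 = b ∧ h (ω i).1 = (!b)).card : ℝ) := by
    intro inst
    rw [Finset.card_filter, Finset.sum_filter]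
    push_cast
    refine Finset.sum_congr rfl fun i _ => ?_
    by_cases q1 : (ω i).2 = b <;> by_cases q2 : h (ω i).1 = (!b) <;>
      simp [f, A, B, q1, q2]
  simp only [Finset.sum_sub_distrib, hs, Finset.sum_const, nsmul_eq_mul, hcnt] at c1 c2
  unfold npGood npRhat penNP
  by_cases hk : 0 < npCnt b ω
  · simp only [hk, if_true]
    specialize c1 hk
    specialize c2 hk
    have hk' : (0:ℝ) < npCnt b ω := by exact_mod_cast hk
    set s := (Finset.univ.filter fun i => (ω i).2 = b ∧ h (ω i).1 = (!b)).card
    set u := Real.sqrt (L / (2 * (npCnt b ω : ℝ)))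
    have hu : 0 ≤ u := Real.sqrt_nonneg _
    have hrh : (s : ℝ≥0∞) / (npCnt b ω : ℝ≥0∞) = ENNReal.ofReal ((s:ℝ) / npCnt b ω) := by
      rw [ENNReal.ofReal_div_of_pos hk', ENNReal.ofReal_natCast, ENNReal.ofReal_natCast]
    have hp0 : 0 ≤ p := ENNReal.toReal_nonneg
    rw [hrh, hR, ← ENNReal.ofReal_add (div_nonneg (Nat.cast_nonneg _) hk'.le) hu, ← ENNReal.ofReal_add hp0 hu]
    constructor <;> apply ENNReal.ofReal_le_ofReal
    · rw [← sub_le_iff_le_add, le_div_iff₀ hk']; linarith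
    · rw [div_le_iff₀ hk']; linarith
  · simp only [hk, if_false]
    exact ⟨by simpa using npR_le_one P b h, by simp⟩

theorem np_union {𝓧 : Type*} [MeasurableSpace 𝓧] (P : Measure (𝓧 × Bool)) [IsProbabilityMeasure P]
    (b : Bool) (hP : 0 < P {z : 𝓧 × Bool | z.2 = b})
    (H : Set (𝓧 → Bool)) (hHcount : H.Countable) (hHmeas : ∀ h ∈ H, Measurable h)
    (cl : (𝓧 → Bool) → ℝ)
    (hKraft : ∑' h : H, (2 : ℝ≥0∞) ^ (-(cl h.1)) ≤ 1)
    (δ : ℝ) (hδ : 0 < δ) (n : ℕ) :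
    (Measure.pi fun _ : Fin n => P) {ω | ∃ h ∈ H, ¬ npGood P b h (cl h) δ ω}
      ≤ ENNReal.ofReal δ := by
  have : Countable H := hHcount
  calc _ ≤ (Measure.pi fun _ : Fin n => P) (⋃ h : H, {ω | ¬ npGood P b h.1 (cl h.1) δ ω}) := by
        apply measure_mono
        rintro ω ⟨h, hh, hg⟩
        exact Set.mem_iUnion.2 ⟨⟨h, hh⟩, hg⟩
    _ ≤ ∑' h : H, (Measure.pi fun _ : Fin n => P) {ω | ¬ npGood P b h.1 (cl h.1) δ ω} :=
        measure_iUnion_le _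
    _ ≤ ∑' h : H, ENNReal.ofReal δ * (2 : ℝ≥0∞) ^ (-(cl h.1)) :=
        ENNReal.tsum_le_tsum fun h => np_dev P b hP h.1 (hHmeas _ h.2) _ δ hδ n
    _ = ENNReal.ofReal δ * ∑' h : H, (2 : ℝ≥0∞) ^ (-(cl h.1)) := ENNReal.tsum_mul_left
    _ ≤ ENNReal.ofReal δ := mul_le_of_le_one_right' hKraft

/-- **Corollary 3 (Neyman–Pearson classification).** Let `H` be countable with codelengths
satisfying the Kraft inequality, let `h*` minimize `R_FN` over `{h ∈ H : R_FP(h) ≤ α}` and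
let `ĥ` minimize `R̂_FN + φ_FN` over `{h ∈ H : R̂_FP(h) ≤ α + φ_FP(h, δ)}`.  Then for any
`δ > 0` and any `n ≥ 1`, with probability at least `1 - 2δ` over the training sample, both
`R_FN(ĥ) ≤ R_FN(h*) + 2φ_FN(h*, δ)` and `R_FP(ĥ) ≤ α + 2φ_FP(ĥ, δ)`. -/
theorem np_constrained_learning
    {𝓧 : Type*} [MeasurableSpace 𝓧] (P : Measure (𝓧 × Bool)) [IsProbabilityMeasure P]
    (hP0 : 0 < P {z : 𝓧 × Bool | z.2 = false})
    (hP1 : 0 < P {z : 𝓧 × Bool | z.2 = true})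
    (H : Set (𝓧 → Bool)) (hHcount : H.Countable) (hHmeas : ∀ h ∈ H, Measurable h)
    (cl : (𝓧 → Bool) → ℝ)
    (hKraft : ∑' h : H, (2 : ℝ≥0∞) ^ (-(cl h.1)) ≤ 1)
    (n : ℕ) (hn : 1 ≤ n)
    (α : ℝ) (hα0 : 0 < α) (hα1 : α < 1)
    (δ : ℝ) (hδ : 0 < δ)
    (hstar : 𝓧 → Bool) (hstar_mem : hstar ∈ H)
    (hstar_feas : RFP P hstar ≤ ENNReal.ofReal α)
    (hstar_min : ∀ h ∈ H, RFP P h ≤ ENNReal.ofReal α → RFN P hstar ≤ RFN P h)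
    (hhat : (Fin n → 𝓧 × Bool) → (𝓧 → Bool))
    (hhat_mem : ∀ ω, hhat ω ∈ H)
    (hhat_feas : ∀ ω, RhatFP (hhat ω) ω ≤
      ENNReal.ofReal α + penNP (cl (hhat ω)) δ (nneg ω))
    (hhat_min : ∀ ω, ∀ h ∈ H, RhatFP h ω ≤ ENNReal.ofReal α + penNP (cl h) δ (nneg ω) →
      RhatFN (hhat ω) ω + penNP (cl (hhat ω)) δ (npos ω) ≤
        RhatFN h ω + penNP (cl h) δ (npos ω)) :
    ENNReal.ofReal (1 - 2 * δ) ≤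
      (Measure.pi fun _ : Fin n => P)
        {ω | RFN P (hhat ω) ≤ RFN P hstar + 2 * penNP (cl hstar) δ (npos ω) ∧
          RFP P (hhat ω) ≤ ENNReal.ofReal α + 2 * penNP (cl (hhat ω)) δ (nneg ω)} := by
  have b0 := np_union P false hP0 H hHcount hHmeas cl hKraft δ hδ n
  have b1 := np_union P true hP1 H hHcount hHmeas cl hKraft δ hδ n
  set μ := Measure.pi fun _ : Fin n => P
  set G : Set (Fin n → 𝓧 × Bool) := {ω | RFN P (hhat ω) ≤ RFN P hstar + 2 * penNP (cl hstar) δ (npos ω) ∧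
          RFP P (hhat ω) ≤ ENNReal.ofReal α + 2 * penNP (cl (hhat ω)) δ (nneg ω)} with hG
  have hGc : μ Gᶜ ≤ ENNReal.ofReal (2 * δ) := by
    have e : ENNReal.ofReal (2 * δ) = ENNReal.ofReal δ + ENNReal.ofReal δ := by
      rw [← ENNReal.ofReal_add hδ.le hδ.le, two_mul]
    rw [e]
    refine le_trans ?_ (add_le_add b0 b1)
    refine le_trans (measure_mono ?_) (measure_union_le _ _)
    intro ω hω
    by_contra hcon
    apply hω
    simp only [Set.mem_union, Set.mem_ofPred_eq, not_or, not_exists, not_and, not_not] at hcon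
    obtain ⟨g0, g1⟩ := hcon
    have s0 : RhatFP hstar ω ≤ RFP P hstar + penNP (cl hstar) δ (nneg ω) := (g0 hstar hstar_mem).2
    have s1 : RhatFN hstar ω ≤ RFN P hstar + penNP (cl hstar) δ (npos ω) := (g1 hstar hstar_mem).2
    have t0 : RFP P (hhat ω) ≤ RhatFP (hhat ω) ω + penNP (cl (hhat ω)) δ (nneg ω) :=
      (g0 _ (hhat_mem ω)).1
    have t1 : RFN P (hhat ω) ≤ RhatFN (hhat ω) ω + penNP (cl (hhat ω)) δ (npos ω) :=
      (g1 _ (hhat_mem ω)).1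
    constructor
    · calc _ ≤ _ := t1
        _ ≤ _ := hhat_min ω hstar hstar_mem (s0.trans (by gcongr))
        _ ≤ RFN P hstar + penNP (cl hstar) δ (npos ω) + penNP (cl hstar) δ (npos ω) := by gcongr
        _ = _ := by rw [two_mul, add_assoc]
    · calc _ ≤ _ := t0
        _ ≤ ENNReal.ofReal α + penNP (cl (hhat ω)) δ (nneg ω) + penNP (cl (hhat ω)) δ (nneg ω) := by
          gcongr; exact hhat_feas ω
        _ = _ := by rw [two_mul, add_assoc]
  rw [ENNReal.ofReal_sub _ (by positivity), ENNReal.ofReal_one, tsub_le_iff_right]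
  calc (1 : ℝ≥0∞) = μ Set.univ := measure_univ.symm
    _ = μ (G ∪ Gᶜ) := by rw [Set.union_compl_self]
    _ ≤ μ G + μ Gᶜ := measure_union_le _ _
    _ ≤ _ := by gcongr
end
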